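/- arXiv:2503.11184 — 4 statements merged into one kernel-verified Lean document; each statement's English description precedes it below -/
import Mathlib

section
/- Let A be an abelian category, n a positive integer, and X_n ⊆ X_{n-1} ⊆ ⋯ ⊆ X_1 ⊆ A a chain of subcategories. For 1 ≤ i ≤ n define T_i to be the subcategory of objects M ∈ A with Ext^j_A(M, X_{j+1}) = 0 for all 0 ≤ j ≤ i−1 (where Ext^0 = Hom). Then for each 0 ≤ i ≤ n−1 (with T_0 = A), T_{i+1} is a torsion class of T_i, i.e., T_{i+1} is closed under conflations and admissible quotients in T_i. -/
open CategoryTheory CategoryTheory.Limits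

universe w v u

namespace Paper

variable {C : Type u} [Category.{v} C] [Abelian C]

/-- A predicate on objects is closed under isomorphisms. -/
def IsoClosedP (P : C → Prop) : Prop := ∀ ⦃A B : C⦄, (A ≅ B) → P A → P B

/-- `P` is closed under extensions in the ambient abelian category. -/
def ClosedUnderExtensions (P : C → Prop) : Prop :=
  ∀ (S : ShortComplex C), S.ShortExact → P S.X₁ → P S.X₃ → P S.X₂

/-- `P ⊆ E` is closed under conflations in `E` (short exact sequences all of whose
terms belong to `E`). -/
def ClosedUnderConflations (E P : C → Prop) : Prop :=
  ∀ (S : ShortComplex C), S.ShortExact → E S.X₁ → E S.X₂ → E S.X₃ →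
    P S.X₁ → P S.X₃ → P S.X₂

/-- `P` is closed under admissible subobjects in `E`. -/
def ClosedUnderAdmissibleSubobjects (E P : C → Prop) : Prop :=
  ∀ (S : ShortComplex C), S.ShortExact → E S.X₁ → E S.X₂ → E S.X₃ →
    P S.X₂ → P S.X₁

/-- `P` is closed under admissible quotients in `E`. -/
def ClosedUnderAdmissibleQuotients (E P : C → Prop) : Prop :=
  ∀ (S : ShortComplex C), S.ShortExact → E S.X₁ → E S.X₂ → E S.X₃ →
    P S.X₂ → P S.X₃

/-- `P` is a torsion-free class of the extension-closed subcategory `E`. -/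
def IsTorsionFreeClassOf (E P : C → Prop) : Prop :=
  IsoClosedP P ∧ (∀ M, P M → E M) ∧ ClosedUnderConflations E P ∧
    ClosedUnderAdmissibleSubobjects E P

/-- `P` is a torsion class of the extension-closed subcategory `E`. -/
def IsTorsionClassOf (E P : C → Prop) : Prop :=
  IsoClosedP P ∧ (∀ M, P M → E M) ∧ ClosedUnderConflations E P ∧
    ClosedUnderAdmissibleQuotients E P

/-- `F` is the smallest torsion-free class of `E` containing `X`. -/
def IsSmallestTorsionFreeClassOf (E X F : C → Prop) : Prop :=
  IsTorsionFreeClassOf E F ∧ (∀ M, X M → F M) ∧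
    ∀ G, IsTorsionFreeClassOf E G → (∀ M, X M → G M) → ∀ M, F M → G M

/-- `F` is the smallest torsion class of `E` containing `X`. -/
def IsSmallestTorsionClassOf (E X F : C → Prop) : Prop :=
  IsTorsionClassOf E F ∧ (∀ M, X M → F M) ∧
    ∀ G, IsTorsionClassOf E G → (∀ M, X M → G M) → ∀ M, F M → G M

/-- `X` is an `n`-fold torsion-free class of the ambient subcategory `Amb`. -/
def IsNFoldTorsionFreeClass (Amb X : C → Prop) (n : ℕ) : Prop :=
  ∃ F : ℕ → (C → Prop), F 0 = Amb ∧ F n = X ∧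
    ∀ i, i < n → IsTorsionFreeClassOf (F i) (F (i+1))

/-- `X` is an `n`-fold torsion class of the ambient subcategory `Amb`. -/
def IsNFoldTorsionClass (Amb X : C → Prop) (n : ℕ) : Prop :=
  ∃ T : ℕ → (C → Prop), T 0 = Amb ∧ T n = X ∧
    ∀ i, i < n → IsTorsionClassOf (T i) (T (i+1))

/-- `X` is closed under `m`-kernels: for every exact sequence
`0 → M → X^0 → ⋯ → X^m` with all `X^i ∈ X` we have `M ∈ X`. -/
def ClosedUnderNKernels (X : C → Prop) (m : ℕ) : Prop :=
  ∀ (F : ComposableArrows C (m+1)), F.Exact →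
    Mono (F.map' 0 1 (by omega) (by omega)) →
    (∀ (i : ℕ) (hi : i ≤ m), X (F.obj ⟨i+1, by omega⟩)) →
    X (F.obj ⟨0, by omega⟩)

/-- `M` has `X`-resolution dimension at most `j`: there is an exact sequence
`0 → X_j → ⋯ → X_0 → M → 0` with all `X_i ∈ X`. -/
def ResDimLE (X : C → Prop) (j : ℕ) (M : C) : Prop :=
  ∃ F : ComposableArrows C (j+1), F.Exact ∧
    Mono (F.map' 0 1 (by omega) (by omega)) ∧
    Epi (F.map' j (j+1) (by omega) (by omega)) ∧
    (∀ (i : ℕ) (hi : i ≤ j), X (F.obj ⟨i, by omega⟩)) ∧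
    F.obj ⟨j+1, by omega⟩ = M


theorem statement2 [HasExt.{w} C] (n : ℕ) (hn : 0 < n) (X : ℕ → (C → Prop))
    (hchain : ∀ i, 1 ≤ i → i + 1 ≤ n → ∀ M, X (i+1) M → X i M) :
    ∀ i, i < n →
      IsTorsionClassOf
        (fun M => ∀ j, j < i → ∀ N : C, X (j+1) N → Subsingleton (Abelian.Ext M N j))
        (fun M => ∀ j, j < i+1 → ∀ N : C, X (j+1) N → Subsingleton (Abelian.Ext M N j)) := by
  intro i hi
  refine ⟨?_, ?_, ?_, ?_⟩
  · intro A B e hA j hj N hN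
    have := hA j hj N hN
    refine subsingleton_of_forall_eq 0 (fun x => ?_)
    have h1 : (Abelian.Ext.mk₀ e.inv).comp ((Abelian.Ext.mk₀ e.hom).comp x (zero_add j))
        (zero_add j) = x := by
      rw [Abelian.Ext.mk₀_comp_mk₀_assoc, e.inv_hom_id, Abelian.Ext.mk₀_id_comp]
    rw [← h1, Subsingleton.elim ((Abelian.Ext.mk₀ e.hom).comp x (zero_add j)) 0,
      Abelian.Ext.comp_zero]
  · intro M hM j hj
    exact hM j (by omega)
  · intro S hS _ _ _ h1 h3 j hj N hN
    have := h1 j hj N hN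
    have := h3 j hj N hN
    refine subsingleton_of_forall_eq 0 (fun x => ?_)
    obtain ⟨y, hy⟩ := Abelian.Ext.contravariant_sequence_exact₂ hS N x (Subsingleton.elim _ _)
    rw [← hy, Subsingleton.elim y 0, Abelian.Ext.comp_zero]
  · intro S hS e1 _ e3 h2 j hj N hN
    by_cases hji : j < i
    · exact e3 j hji N hN
    obtain rfl : j = i := by omega
    have := h2 j hj N hN
    refine subsingleton_of_forall_eq 0 (fun x => ?_)
    cases j with
    | zero =>
      have := hS.epi_g
      exact Abelian.Ext.precomp_mk₀_injective_of_epi N S.g (Subsingleton.elim _ _)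
    | succ k =>
      have := e1 k (by omega) N (hchain (k+1) (by omega) (by omega) N hN)
      obtain ⟨y, hy⟩ := Abelian.Ext.contravariant_sequence_exact₃ hS N x
        (Subsingleton.elim _ _) (n₀ := k) (by omega)
      rw [← hy, Subsingleton.elim y 0, Abelian.Ext.comp_zero]
end Paper
end

section
/- Let A be an abelian category with enough projectives and injectives, (X, Y) a hereditary cotorsion pair in A, and for j ≥ 0 let F_j = {M ∈ A | Ext^i_A(M, Y') = 0 for all i > j and Y' ∈ Y}. Then F_j = {M ∈ A | the X-resolution dimension of M is at most j}. -/
open CategoryTheory CategoryTheory.Limits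

universe w v u

namespace Paper

variable {C : Type u} [Category.{v} C] [Abelian C]

/-- All `Ext`-groups of degree `> a` from `M` to objects of `Y` vanish. -/
def ExtVan [HasExt.{w} C] (Y : C → Prop) (a : ℕ) (M : C) : Prop :=
  ∀ i, a < i → ∀ N : C, Y N → Subsingleton (Abelian.Ext.{w} M N i)

lemma ExtVan.of_iso [HasExt.{w} C] {Y : C → Prop} {a : ℕ} {M M' : C} (e : M ≅ M')
    (h : ExtVan.{w} Y a M) : ExtVan.{w} Y a M' := by
  intro i hi N hN
  have := h i hi N hN
  refine subsingleton_of_forall_eq 0 fun x => ?_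
  have h1 : (Abelian.Ext.mk₀ e.inv).comp
      ((Abelian.Ext.mk₀ e.hom).comp x (zero_add i)) (zero_add i) = x := by
    simp
  rw [← h1, Subsingleton.elim ((Abelian.Ext.mk₀ e.hom).comp x (zero_add i)) 0,
    Abelian.Ext.comp_zero]

lemma ExtVan.quot [HasExt.{w} C] {Y : C → Prop} {a : ℕ} {S : ShortComplex C}
    (hS : S.ShortExact) (h1 : ExtVan.{w} Y a S.X₁) (h2 : ExtVan.{w} Y 0 S.X₂) :
    ExtVan.{w} Y (a + 1) S.X₃ := by
  intro i hi N hN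
  obtain ⟨i, rfl⟩ : ∃ k, i = 1 + k := ⟨i - 1, by omega⟩
  have := h1 i (by omega) N hN
  have := h2 (1 + i) (by omega) N hN
  refine subsingleton_of_forall_eq 0 fun x => ?_
  obtain ⟨y, rfl⟩ := Abelian.Ext.contravariant_sequence_exact₃ hS N x
    (Subsingleton.elim _ _) rfl
  rw [Subsingleton.elim y 0, Abelian.Ext.comp_zero]

lemma ExtVan.sub [HasExt.{w} C] {Y : C → Prop} {a : ℕ} {S : ShortComplex C}
    (hS : S.ShortExact) (h3 : ExtVan.{w} Y (a + 1) S.X₃) (h2 : ExtVan.{w} Y 0 S.X₂) :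
    ExtVan.{w} Y a S.X₁ := by
  intro i hi N hN
  have := h3 (1 + i) (by omega) N hN
  have := h2 i (by omega) N hN
  refine subsingleton_of_forall_eq 0 fun x => ?_
  obtain ⟨y, rfl⟩ := Abelian.Ext.contravariant_sequence_exact₁ hS N x rfl
    (Subsingleton.elim _ _)
  rw [Subsingleton.elim y 0, Abelian.Ext.comp_zero]

lemma ExtVan.of_projective [HasExt.{w} C] (Y : C → Prop) (P : C) [Projective P] :
    ExtVan.{w} Y 0 P := by
  intro i hi N _
  obtain ⟨i, rfl⟩ : ∃ k, i = k + 1 := ⟨i - 1, by omega⟩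
  exact Abelian.Ext.subsingleton_of_projective P N i

/-- Dimension shifting along an exact sequence, from the left. -/
lemma extVan_image [HasExt.{w} C] {Y : C → Prop} {j : ℕ} (F : ComposableArrows C (j + 1))
    (hF : F.Exact) (hm : Mono (F.map' 0 1 (by omega) (by omega)))
    (h : ∀ (i : ℕ) (hi : i ≤ j), ExtVan.{w} Y 0 (F.obj ⟨i, by omega⟩))
    (k : ℕ) (hk : k ≤ j) :
    ∃ (K : C) (e : F.obj ⟨k, by omega⟩ ⟶ K) (m : K ⟶ F.obj ⟨k + 1, by omega⟩),
      Epi e ∧ Mono m ∧ e ≫ m = F.map' k (k + 1) ∧ ExtVan.{w} Y k K := by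
  induction k with
  | zero => exact ⟨_, 𝟙 _, F.map' 0 1, inferInstance, hm, Category.id_comp _, h 0 hk⟩
  | succ k ih =>
    obtain ⟨K, e, m, he, hm, fac, hK⟩ := ih (by omega)
    have hz := hF.zero k (by omega)
    have hex := hF.exact k (by omega)
    have hz' : m ≫ F.map' (k + 1) (k + 2) = 0 := by
      rw [← cancel_epi e, comp_zero, ← hz, ← fac, Category.assoc]
    let φ : ShortComplex.mk (F.map' k (k + 1)) (F.map' (k + 1) (k + 2)) hz ⟶
        ShortComplex.mk m (F.map' (k + 1) (k + 2)) hz' :=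
      { τ₁ := e
        τ₂ := 𝟙 _
        τ₃ := 𝟙 _
        comm₁₂ := by simpa using fac
        comm₂₃ := by simp }
    have : Epi φ.τ₁ := he
    have : IsIso φ.τ₂ := inferInstanceAs (IsIso (𝟙 _))
    have : Mono φ.τ₃ := inferInstanceAs (Mono (𝟙 _))
    have hex' := (ShortComplex.exact_iff_of_epi_of_isIso_of_mono φ).1 hex
    have hmono := hex'.mono_cokernelDesc
    refine ⟨cokernel m, cokernel.π m, cokernel.desc m _ hz', inferInstance, hmono,
      cokernel.π_desc _ _ _, ?_⟩
    have hS : (ShortComplex.mk m (cokernel.π m) (cokernel.condition m)).ShortExact :=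
      { exact := ShortComplex.exact_of_g_is_cokernel _ (cokernelIsCokernel m)
        mono_f := hm
        epi_g := inferInstanceAs (Epi (cokernel.π m)) }
    exact ExtVan.quot hS hK (h (k + 1) hk)

lemma extVan_of_resDimLE [HasExt.{w} C] {X Y : C → Prop} (hXY : ∀ M, X M → ExtVan.{w} Y 0 M)
    {j : ℕ} {M : C} (h : ResDimLE X j M) : ExtVan.{w} Y j M := by
  obtain ⟨F, hF, hm, hepi, hX, rfl⟩ := h
  obtain ⟨K, e, m, he, hm', fac, hK⟩ :=
    extVan_image F hF hm (fun i hi => hXY _ (hX i hi)) j le_rfl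
  have : Epi m := by
    have : Epi (e ≫ m) := by rw [fac]; exact hepi
    exact epi_of_epi e m
  have : IsIso m := isIso_of_mono_of_epi m
  exact hK.of_iso (asIso m)

lemma exact_step {j : ℕ} (F : ComposableArrows C j) {K P : C} (f : K ⟶ F.left)
    (hF : (F.precomp f).Exact) (hf : Mono f) (π : P ⟶ K) [Epi π] :
    ((F.precomp (π ≫ f)).precomp (kernel.ι π)).Exact := by
  refine ComposableArrows.exact_of_δ₀ ?_ ?_
  · have w : kernel.ι π ≫ π ≫ f = 0 := by simp
    refine ComposableArrows.exact₂_mk _ w ?_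
    have w0 : kernel.ι π ≫ π = 0 := by simp
    have h0 : (ShortComplex.mk (kernel.ι π) π w0).Exact :=
      ShortComplex.exact_of_f_is_kernel _ (kernelIsKernel π)
    let φ : ShortComplex.mk (kernel.ι π) π w0 ⟶ ShortComplex.mk (kernel.ι π) (π ≫ f) w :=
      { τ₁ := 𝟙 _
        τ₂ := 𝟙 _
        τ₃ := f }
    have : Epi φ.τ₁ := inferInstanceAs (Epi (𝟙 _))
    have : IsIso φ.τ₂ := inferInstanceAs (IsIso (𝟙 _))
    have : Mono φ.τ₃ := hf
    exact (ShortComplex.exact_iff_of_epi_of_isIso_of_mono φ).1 h0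
  · change (F.precomp (π ≫ f)).Exact
    obtain _ | j := j
    · exact ComposableArrows.exact₁ _
    · have hF0 : F.Exact := ComposableArrows.Exact.δ₀ hF
      refine ComposableArrows.exact_of_δ₀ ?_ hF0
      have w0 : f ≫ F.map' 0 1 = 0 := hF.zero 0 (by omega)
      have h0 : (ShortComplex.mk f (F.map' 0 1) w0).Exact := hF.exact 0 (by omega)
      have w : (π ≫ f) ≫ F.map' 0 1 = 0 := by rw [Category.assoc, w0, comp_zero]
      refine ComposableArrows.exact₂_mk _ w ?_
      let φ : ShortComplex.mk (π ≫ f) (F.map' 0 1) w ⟶ ShortComplex.mk f (F.map' 0 1) w0 :=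
        { τ₁ := π
          τ₂ := 𝟙 _
          τ₃ := 𝟙 _
          comm₁₂ := (Category.comp_id _).symm
          comm₂₃ := (Category.id_comp _).trans (Category.comp_id _).symm }
      have : Epi φ.τ₁ := inferInstanceAs (Epi π)
      have : IsIso φ.τ₂ := inferInstanceAs (IsIso (𝟙 _))
      have : Mono φ.τ₃ := inferInstanceAs (Mono (𝟙 _))
      exact (ShortComplex.exact_iff_of_epi_of_isIso_of_mono φ).2 h0

lemma exists_syzygy [EnoughProjectives C] [HasExt.{w} C] (Y : C → Prop) (M : C) (j : ℕ) :
    ∃ F : ComposableArrows C (j + 1), F.Exact ∧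
      Mono (F.map' 0 1 (by omega) (by omega)) ∧
      Epi (F.map' j (j + 1) (by omega) (by omega)) ∧
      (∀ (i : ℕ) (hi : i + 1 ≤ j), Projective (F.obj ⟨i + 1, by omega⟩)) ∧
      F.obj ⟨j + 1, by omega⟩ = M ∧
      ∀ a, ExtVan.{w} Y (a + j) M → ExtVan.{w} Y a (F.obj ⟨0, by omega⟩) := by
  induction j with
  | zero =>
    refine ⟨ComposableArrows.mk₁ (𝟙 M), ComposableArrows.exact₁ _,
      inferInstanceAs (Mono (𝟙 M)), inferInstanceAs (Epi (𝟙 M)), ?_, rfl, fun a h => h⟩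
    intro i hi
    omega
  | succ j ih =>
    obtain ⟨F, hF, hm, he, hP, hM, hE⟩ := ih
    obtain ⟨F, K, f, rfl⟩ := ComposableArrows.precomp_surjective F
    have hf : Mono f := hm
    let π := Projective.π K
    refine ⟨(F.precomp (π ≫ f)).precomp (kernel.ι π), exact_step F f hF hf π,
      inferInstanceAs (Mono (kernel.ι π)), ?_, ?_, hM, ?_⟩
    · obtain _ | j := j
      · have : Epi f := he
        exact inferInstanceAs (Epi (π ≫ f))
      · exact he
    · intro i hi
      obtain _ | i := i
      · exact inferInstanceAs (Projective (Projective.over K))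
      · exact hP i (by omega)
    · intro a ha
      have hK : ExtVan.{w} Y (a + 1) K := hE (a + 1) (by rwa [add_assoc, add_comm 1 j])
      have hS : (ShortComplex.mk (kernel.ι π) π (kernel.condition π)).ShortExact :=
        { exact := ShortComplex.exact_of_f_is_kernel _ (kernelIsKernel π)
          mono_f := inferInstanceAs (Mono (kernel.ι π))
          epi_g := inferInstanceAs (Epi (Projective.π K)) }
      exact ExtVan.sub hS hK (ExtVan.of_projective Y (Projective.over K))

theorem statement12 [EnoughProjectives C] [EnoughInjectives C] [HasExt.{w} C]
    (X Y : C → Prop)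
    (hX : ∀ M : C, X M ↔ ∀ N : C, Y N → Subsingleton (Abelian.Ext M N 1))
    (hY : ∀ N : C, Y N ↔ ∀ M : C, X M → Subsingleton (Abelian.Ext M N 1))
    (hHered : ∀ i, 0 < i → ∀ M N : C, X M → Y N → Subsingleton (Abelian.Ext M N i))
    (j : ℕ) :
    ∀ M : C, (∀ i, j < i → ∀ N : C, Y N → Subsingleton (Abelian.Ext M N i)) ↔
      ResDimLE X j M := by
  intro M
  constructor
  · intro h
    obtain ⟨F, hF, hm, he, hP, hM, hE⟩ := exists_syzygy.{w} Y M j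
    refine ⟨F, hF, hm, he, ?_, hM⟩
    intro i hi
    rw [hX]
    intro N hN
    obtain _ | i := i
    · exact hE 0 (by rw [zero_add]; exact h) 1 one_pos N hN
    · have := hP i hi
      exact ExtVan.of_projective Y _ 1 one_pos N hN
  · intro h
    exact extVan_of_resDimLE (fun M hM i hi N hN => hHered i hi M N hM hN) h

end Paper
end

section
/- Let A be an abelian category with enough projectives and injectives, (X, Y) a hereditary cotorsion pair, and n a positive integer. The following are equivalent: (a) X is an n-fold torsion-free class of A; (b) X is closed under extensions and (n−1)-kernels; (c) every object of A has X-resolution dimension at most n. -/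
open CategoryTheory CategoryTheory.Limits

universe w v u

namespace Paper

variable {C : Type u} [Category.{v} C] [Abelian C]

lemma shortExact_aux {A B D Z : C} (p : A ⟶ Z) (i : Z ⟶ B) (g : B ⟶ D) [Epi p] [Mono i]
    (w : (p ≫ i) ≫ g = 0) (h : (ShortComplex.mk (p ≫ i) g w).Exact) :
    ∃ w' : i ≫ factorThruImage g = 0,
      (ShortComplex.mk i (factorThruImage g) w').ShortExact := by
  have w1 : i ≫ g = 0 := by
    rw [← cancel_epi p, ← Category.assoc, w, comp_zero]
  have w' : i ≫ factorThruImage g = 0 := by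
    rw [← cancel_mono (image.ι g), Category.assoc, image.fac, w1, zero_comp]
  refine ⟨w', ?_⟩
  have h1 : (ShortComplex.mk i g w1).Exact := by
    let φ : ShortComplex.mk (p ≫ i) g w ⟶ ShortComplex.mk i g w1 :=
      { τ₁ := p, τ₂ := 𝟙 _, τ₃ := 𝟙 _ }
    have : Epi φ.τ₁ := by dsimp [φ]; infer_instance
    have : IsIso φ.τ₂ := by dsimp [φ]; infer_instance
    have : Mono φ.τ₃ := by dsimp [φ]; infer_instance
    exact (ShortComplex.exact_iff_of_epi_of_isIso_of_mono φ).1 h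
  have h2 : (ShortComplex.mk i (factorThruImage g) w').Exact := by
    let φ : ShortComplex.mk i (factorThruImage g) w' ⟶ ShortComplex.mk i g w1 :=
      { τ₁ := 𝟙 _, τ₂ := 𝟙 _, τ₃ := image.ι g }
    have : Epi φ.τ₁ := by dsimp [φ]; infer_instance
    have : IsIso φ.τ₂ := by dsimp [φ]; infer_instance
    have : Mono φ.τ₃ := by dsimp [φ]; infer_instance
    exact (ShortComplex.exact_iff_of_epi_of_isIso_of_mono φ).2 h1
  exact { exact := h2, mono_f := inferInstance, epi_g := inferInstance }

lemma exact_first_aux {m : ℕ} (F : ComposableArrows C (m + 2)) (hF : F.Exact)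
    {Z : C} (p : F.obj ⟨0, by omega⟩ ⟶ Z) (i : Z ⟶ F.obj ⟨1, by omega⟩) [Epi p] [Mono i]
    (hpi : p ≫ i = F.map' 0 1 (by omega) (by omega)) :
    ∃ w' : i ≫ factorThruImage (F.map' 1 2 (by omega) (by omega)) = 0,
      (ShortComplex.mk i (factorThruImage (F.map' 1 2 (by omega) (by omega))) w').ShortExact := by
  have w : F.map' 0 1 (by omega) (by omega) ≫ F.map' 1 2 (by omega) (by omega) = 0 :=
    hF.toIsComplex.zero 0 (by omega)
  have h : (ShortComplex.mk _ _ w).Exact := hF.exact 0 (by omega)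
  refine shortExact_aux p i _ (by rw [hpi]; exact w) ?_
  simp only [hpi]
  exact h

/-- Iterating the passage to (admissible) subobjects along an exact sequence. -/
lemma kernel_aux (X : C → Prop) (G : ℕ → C → Prop) (n : ℕ) (h0 : ∀ M, G 0 M)
    (hs : ∀ i, i < n → ∀ S : ShortComplex C, S.ShortExact → X S.X₂ → G i S.X₃ → G (i + 1) S.X₁)
    (m : ℕ) : ∀ (_ : m + 1 ≤ n) (F : ComposableArrows C (m + 1)) (_ : F.Exact)
      (_ : ∀ (i : ℕ) (hi : i ≤ m), X (F.obj ⟨i + 1, by omega⟩))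
      (Z : C) (p : F.obj ⟨0, by omega⟩ ⟶ Z) (i : Z ⟶ F.obj ⟨1, by omega⟩) (_ : Epi p) (_ : Mono i)
      (_ : p ≫ i = F.map' 0 1 (by omega) (by omega)), G (m + 1) Z := by
  induction m with
  | zero =>
    intro hm F hF hX Z p i _ _ hpi
    refine hs 0 (by omega) (ShortComplex.mk i (cokernel.π i) (by simp)) ?_ (hX 0 le_rfl) (h0 _)
    exact { exact := ShortComplex.exact_cokernel i, mono_f := inferInstance,
            epi_g := inferInstanceAs (Epi (cokernel.π i)) }
  | succ m ih =>
    intro hm F hF hX Z p i _ _ hpi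
    obtain ⟨w', hS⟩ := exact_first_aux F hF p i hpi
    have hg : 2 ≤ m + 1 + 1 := by omega
    let g := F.map' 1 2 (by decide) hg
    have hg1 : Epi (factorThruImage g) := inferInstance
    have hg2 : Mono (image.ι g) := inferInstance
    refine hs (m + 1) (by omega) _ hS (hX 0 (by omega)) ?_
    exact ih (by omega) F.δ₀ hF.δ₀ (fun i hi => hX (i + 1) (by omega)) _
      (factorThruImage g) (image.ι g) hg1 hg2
      (image.fac g)

/-- Vanishing of `Ext` against `Y` in degrees above `k`. -/
def ExtVanish [HasExt.{w} C] (Y : C → Prop) (k : ℕ) (M : C) : Prop :=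
  ∀ j, k < j → ∀ N, Y N → Subsingleton (Abelian.Ext.{w} M N j)

section ext
variable [HasExt.{w} C]

lemma ext_mid (S : ShortComplex C) (hS : S.ShortExact) (N : C) (j : ℕ)
    (h1 : Subsingleton (Abelian.Ext.{w} S.X₁ N j)) (h3 : Subsingleton (Abelian.Ext.{w} S.X₃ N j)) :
    Subsingleton (Abelian.Ext.{w} S.X₂ N j) := by
  refine subsingleton_of_forall_eq 0 fun x => ?_
  obtain ⟨y, hy⟩ := Abelian.Ext.contravariant_sequence_exact₂ hS N x (Subsingleton.elim _ _)
  rw [← hy, Subsingleton.elim y 0, Abelian.Ext.comp_zero]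

lemma ext_sub (S : ShortComplex C) (hS : S.ShortExact) (N : C) (j : ℕ)
    (h2 : Subsingleton (Abelian.Ext.{w} S.X₂ N j))
    (h3 : Subsingleton (Abelian.Ext.{w} S.X₃ N (1 + j))) :
    Subsingleton (Abelian.Ext.{w} S.X₁ N j) := by
  refine subsingleton_of_forall_eq 0 fun x => ?_
  obtain ⟨y, hy⟩ := Abelian.Ext.contravariant_sequence_exact₁ hS N x rfl (Subsingleton.elim _ _)
  rw [← hy, Subsingleton.elim y 0, Abelian.Ext.comp_zero]

lemma ext_quot (S : ShortComplex C) (hS : S.ShortExact) (N : C) (j : ℕ)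
    (h1 : Subsingleton (Abelian.Ext.{w} S.X₁ N j))
    (h2 : Subsingleton (Abelian.Ext.{w} S.X₂ N (1 + j))) :
    Subsingleton (Abelian.Ext.{w} S.X₃ N (1 + j)) := by
  refine subsingleton_of_forall_eq 0 fun x => ?_
  obtain ⟨y, hy⟩ := Abelian.Ext.contravariant_sequence_exact₃ hS N x (Subsingleton.elim _ _) rfl
  rw [← hy, Subsingleton.elim y 0, Abelian.Ext.comp_zero]

lemma ext_iso {A B : C} (e : A ≅ B) (N : C) (j : ℕ) (h : Subsingleton (Abelian.Ext.{w} A N j)) :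
    Subsingleton (Abelian.Ext.{w} B N j) := by
  refine subsingleton_of_forall_eq 0 fun x => ?_
  have : (Abelian.Ext.mk₀ e.inv).comp ((Abelian.Ext.mk₀ e.hom).comp x (zero_add j)) (zero_add j)
      = x := by
    rw [Abelian.Ext.mk₀_comp_mk₀_assoc, e.inv_hom_id, Abelian.Ext.mk₀_id_comp]
  rw [← this, Subsingleton.elim ((Abelian.Ext.mk₀ e.hom).comp x (zero_add j)) 0,
    Abelian.Ext.comp_zero]

lemma ExtVanish.iso {Y : C → Prop} {k : ℕ} {A B : C} (e : A ≅ B) (h : ExtVanish.{w} Y k A) :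
    ExtVanish.{w} Y k B := fun j hj N hN => ext_iso e N j (h j hj N hN)

lemma resolution_aux (Y : C → Prop) (m : ℕ) :
    ∀ (k : ℕ) (F : ComposableArrows C (m + 1)) (_ : F.Exact)
      (_ : Epi (F.map' m (m + 1) (by omega) (by omega)))
      (_ : ∀ (i : ℕ) (hi : i < m), ExtVanish.{w} Y 0 (F.obj ⟨i + 1, by omega⟩))
      (Z : C) (p : F.obj ⟨0, by omega⟩ ⟶ Z) (i : Z ⟶ F.obj ⟨1, by omega⟩) (_ : Epi p) (_ : Mono i)
      (_ : p ≫ i = F.map' 0 1 (by omega) (by omega)) (_ : ExtVanish.{w} Y k Z),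
      ExtVanish.{w} Y (k + m) (F.obj ⟨m + 1, by omega⟩) := by
  induction m with
  | zero =>
    intro k F hF hepi hX Z p i _ _ hpi hZ
    have : Epi (p ≫ i) := by rw [hpi]; exact hepi
    have : Epi i := epi_of_epi p i
    have : IsIso i := isIso_of_mono_of_epi i
    exact ExtVanish.iso (asIso i) hZ
  | succ m ih =>
    intro k F hF hepi hX Z p i _ _ hpi hZ
    obtain ⟨w', hS⟩ := exact_first_aux F hF p i hpi
    have hg : 2 ≤ m + 1 + 1 := by omega
    let g := F.map' 1 2 (by decide) hg
    have hg1 : Epi (factorThruImage g) := inferInstance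
    have hg2 : Mono (image.ι g) := inferInstance
    have hZ' : ExtVanish.{w} Y (k + 1) (image (F.map' 1 2 (by omega) (by omega))) := by
      intro j hj N hN
      obtain ⟨j, rfl⟩ : ∃ j', j = 1 + j' := ⟨j - 1, by omega⟩
      exact ext_quot _ hS N j (hZ j (by omega) N hN) (hX 0 (by omega) _ (by omega) N hN)
    have := ih (k + 1) F.δ₀ hF.δ₀ hepi (fun i hi => hX (i + 1) (by omega)) _
      (factorThruImage g) (image.ι g) hg1 hg2
      (image.fac g) hZ'
    intro j hj
    exact this j (by omega)

end ext

lemma exact_precomp {m : ℕ} (F : ComposableArrows C (m + 1)) (hF : F.Exact) {A : C}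
    (f : A ⟶ F.left) (w : f ≫ F.map' 0 1 (by omega) (by omega) = 0)
    (h : (ShortComplex.mk f (F.map' 0 1 (by omega) (by omega)) w).Exact) :
    (F.precomp f).Exact := by
  refine ComposableArrows.exact_of_δ₀ ?_ hF
  exact ComposableArrows.exact₂_mk _ w h

lemma exists_projective_aux [EnoughProjectives C] (M : C) (m : ℕ) :
    ∃ F : ComposableArrows C (m + 1), F.Exact ∧
      Epi (F.map' m (m + 1) (by omega) (by omega)) ∧
      (∀ (i : ℕ) (hi : i ≤ m), Projective (F.obj ⟨i, by omega⟩)) ∧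
      F.obj ⟨m + 1, by omega⟩ = M := by
  induction m with
  | zero =>
    refine ⟨ComposableArrows.mk₁ (Projective.π M), ComposableArrows.exact₁ _,
      inferInstanceAs (Epi (Projective.π M)), ?_, rfl⟩
    intro i hi
    obtain rfl : i = 0 := by omega
    exact inferInstanceAs (Projective (Projective.over M))
  | succ m ih =>
    obtain ⟨F, hF, hepi, hP, hM⟩ := ih
    let g := F.map' 0 1 (by omega) (by omega)
    have w : (Projective.π (kernel g) ≫ kernel.ι g) ≫ g = 0 := by
      rw [Category.assoc, kernel.condition, comp_zero]
    have hex : (ShortComplex.mk (Projective.π (kernel g) ≫ kernel.ι g) g w).Exact := by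
      let φ : ShortComplex.mk (Projective.π (kernel g) ≫ kernel.ι g) g w ⟶
          ShortComplex.mk (kernel.ι g) g (kernel.condition g) :=
        { τ₁ := Projective.π _, τ₂ := 𝟙 _, τ₃ := 𝟙 _ }
      have : Epi φ.τ₁ := by dsimp [φ]; infer_instance
      have : IsIso φ.τ₂ := by dsimp [φ]; infer_instance
      have : Mono φ.τ₃ := by dsimp [φ]; infer_instance
      exact (ShortComplex.exact_iff_of_epi_of_isIso_of_mono φ).2 (ShortComplex.exact_kernel g)
    refine ⟨F.precomp (Projective.π (kernel g) ≫ kernel.ι g), exact_precomp F hF _ w hex,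
      hepi, ?_, hM⟩
    intro i hi
    obtain _ | i := i
    · exact inferInstanceAs (Projective (Projective.over (kernel g)))
    · exact hP i (by omega)

lemma nFold_closed (X : C → Prop) (m : ℕ)
    (h : IsNFoldTorsionFreeClass (fun _ => True) X (m + 1)) :
    ClosedUnderExtensions X ∧ ClosedUnderNKernels X m := by
  obtain ⟨F, hF0, hFn, hF⟩ := h
  have hext : ∀ i, i ≤ m + 1 → ClosedUnderExtensions (F i) := by
    intro i
    induction i with
    | zero => intro _ S _ _ _; rw [hF0]; trivial
    | succ i ih =>
      intro hi S hS h1 h3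
      obtain ⟨_, hsub, hconf, _⟩ := hF i (by omega)
      exact hconf S hS (hsub _ h1) (ih (by omega) S hS (hsub _ h1) (hsub _ h3)) (hsub _ h3) h1 h3
  have hle : ∀ j i, i + j = m + 1 → ∀ M, X M → F i M := by
    intro j
    induction j with
    | zero => intro i hi M hM; obtain rfl : i = m + 1 := by omega
              rw [hFn]; exact hM
    | succ j ih =>
      intro i hi M hM
      exact (hF i (by omega)).2.1 M (ih (i + 1) (by omega) M hM)
  refine ⟨hFn ▸ hext (m + 1) le_rfl, ?_⟩
  intro D hD hmono hX
  have key := kernel_aux X (fun i M => F i M ∧ ∀ j ≤ i, F j M) (m + 1)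
    (fun M => by
      have : F 0 M := by rw [hF0]; trivial
      exact ⟨this, fun j hj => by obtain rfl : j = 0 := by omega
                                  exact this⟩)
    (fun i hi S hS h2 h3 => by
      have hall : ∀ j ≤ i + 1, F j S.X₁ := by
        intro j
        induction j with
        | zero => intro _; rw [hF0]; trivial
        | succ j ih =>
          intro hj
          obtain ⟨_, _, _, hadm⟩ := hF j (by omega)
          exact hadm S hS (ih (by omega)) (hle (m + 1 - j) j (by omega) _ h2)
            (h3.2 j (by omega)) (hle (m + 1 - (j + 1)) (j + 1) (by omega) _ h2)
      exact ⟨hall _ le_rfl, hall⟩)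
    m le_rfl D hD hX _ (𝟙 _) (D.map' 0 1 (by omega) (by omega)) inferInstance hmono
    (Category.id_comp _)
  exact hFn ▸ key.1

lemma closed_resDim [EnoughProjectives C] (X : C → Prop) (hP : ∀ P : C, Projective P → X P) (m : ℕ)
    (h : ClosedUnderNKernels X m) (M : C) : ResDimLE X (m + 1) M := by
  obtain ⟨F, hF, hepi, hproj, hM⟩ := exists_projective_aux M m
  let g := F.map' 0 1 (by omega) (by omega)
  have hex : (F.precomp (kernel.ι g)).Exact :=
    exact_precomp F hF _ (kernel.condition g) (ShortComplex.exact_kernel g)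
  have hmono : Mono (kernel.ι g) := inferInstance
  refine ⟨F.precomp (kernel.ι g), hex, hmono, hepi, ?_, hM⟩
  intro i hi
  obtain _ | i := i
  · exact h (F.precomp (kernel.ι g)).δlast hex.δlast hmono
      (fun i hi => hP _ (hproj i hi))
  · exact hP _ (hproj i (by omega))

theorem statement13 [EnoughProjectives C] [EnoughInjectives C] [HasExt.{w} C]
    (X Y : C → Prop)
    (hX : ∀ M : C, X M ↔ ∀ N : C, Y N → Subsingleton (Abelian.Ext M N 1))
    (hY : ∀ N : C, Y N ↔ ∀ M : C, X M → Subsingleton (Abelian.Ext M N 1))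
    (hHered : ∀ i, 0 < i → ∀ M N : C, X M → Y N → Subsingleton (Abelian.Ext M N i))
    (n : ℕ) (hn : 0 < n) :
    (IsNFoldTorsionFreeClass (fun _ => True) X n ↔
       (ClosedUnderExtensions X ∧ ClosedUnderNKernels X (n-1))) ∧
    ((ClosedUnderExtensions X ∧ ClosedUnderNKernels X (n-1)) ↔
       ∀ M : C, ResDimLE X n M) := by
  obtain ⟨m, rfl⟩ : ∃ m, n = m + 1 := ⟨n - 1, by omega⟩
  have hX0 : ∀ M, X M ↔ ExtVanish.{w} Y 0 M := fun M =>
    ⟨fun h j hj N hN => hHered j hj M N h hN, fun h => (hX M).2 fun N hN => h 1 (by omega) N hN⟩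
  have hP : ∀ P : C, Projective P → X P := fun P _ =>
    (hX P).2 fun N _ => Abelian.Ext.subsingleton_of_projective P N 0
  have ca : (∀ M : C, ResDimLE X (m + 1) M) → IsNFoldTorsionFreeClass (fun _ => True) X (m + 1) := by
    intro hc
    refine ⟨fun i => ExtVanish.{w} Y (m + 1 - i), ?_, ?_, ?_⟩
    · funext M
      refine eq_true ?_
      obtain ⟨F, hF, hmono, hepi, hFX, rfl⟩ := hc M
      have := resolution_aux Y (m + 1) 0 F hF hepi
        (fun i hi => (hX0 _).1 (hFX (i + 1) (by omega))) _ (𝟙 _)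
        (F.map' 0 1 (by omega) (by omega)) inferInstance hmono (Category.id_comp _)
        ((hX0 _).1 (hFX 0 (by omega)))
      intro j hj
      exact this j (by omega)
    · funext M
      simp only [Nat.sub_self]
      exact propext (hX0 M).symm
    · intro i hi
      refine ⟨fun A B e h => h.iso e, fun M h j hj => h j (by omega), ?_, ?_⟩
      · intro S hS _ _ _ h1 h3 j hj N hN
        exact ext_mid S hS N j (h1 j hj N hN) (h3 j hj N hN)
      · intro S hS _ _ h3 h2 j hj N hN
        exact ext_sub S hS N j (h2 j hj N hN) (h3 (1 + j) (by omega) N hN)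
  have ab := nFold_closed X m
  have bc : ClosedUnderExtensions X ∧ ClosedUnderNKernels X m → ∀ M : C, ResDimLE X (m + 1) M :=
    fun h => closed_resDim X hP m h.2
  exact ⟨⟨ab, fun h => ca (bc h)⟩, ⟨bc, fun h => ab (ca h)⟩⟩
end Paper
end

section
/- Let Λ be a finite dimensional algebra over an algebraically closed field and U a τ-rigid module in mod Λ. For every nonnegative integer n, the subcategory cok_{n-1}(U) of (n−1)-cokernels of exact sequences in add U coincides with the n-fold torsion closure of add U; in particular cok_{n-1}(U) is an n-fold torsion class of mod Λ and is closed under extensions. -/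
open CategoryTheory CategoryTheory.Limits

universe w v u

namespace Paper

variable {C : Type u} [Category.{v} C] [Abelian C]

attribute [local instance] CategoryTheory.Abelian.hasFiniteBiproducts

/-- `add U`: direct summands of finite direct sums of copies of `U`. -/
def AddP (U : C) : C → Prop := fun M =>
  ∃ (k : ℕ) (i : M ⟶ ⨁ (fun _ : Fin k => U)) (p : (⨁ (fun _ : Fin k => U)) ⟶ M),
    i ≫ p = 𝟙 M

/-- `Fac U`: quotients of objects of `add U`. -/
def FacP (U : C) : C → Prop := fun M =>
  ∃ (A : C) (p : A ⟶ M), AddP U A ∧ Epi p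

/-- `CokP Amb U n` is `cok_{n-1} U`: objects admitting an exact sequence
`U_{n-1} → ⋯ → U_0 → M → 0` with all `U_i ∈ add U`; for `n = 0` it is the
ambient subcategory (`cok_{-1} U`). -/
def CokP (Amb : C → Prop) (U : C) : ℕ → (C → Prop)
  | 0 => Amb
  | (n+1) => fun M => ∃ F : ComposableArrows C (n+1), F.Exact ∧
      Epi (F.map' n (n+1) (by omega) (by omega)) ∧
      (∀ (i : ℕ) (hi : i ≤ n), AddP U (F.obj ⟨i, by omega⟩)) ∧
      F.obj ⟨n+1, by omega⟩ = M

attribute [local instance] CategoryTheory.Abelian.hasFiniteBiproducts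

/-! ### Helper material -/

/-- Working form of a short exact sequence. -/
def SES {X Y Z : C} (f : X ⟶ Y) (g : Y ⟶ Z) : Prop :=
  Mono f ∧ Epi g ∧ f ≫ g = 0 ∧ ∀ ⦃W : C⦄ (x : W ⟶ Y), x ≫ g = 0 → ∃ y : W ⟶ X, y ≫ f = x

lemma SES.of_shortExact {S : ShortComplex C} (h : S.ShortExact) : SES S.f S.g := by
  have := h.mono_f
  have := h.epi_g
  exact ⟨h.mono_f, h.epi_g, S.zero, fun W x hx => ⟨h.exact.lift x hx, h.exact.lift_f x hx⟩⟩

lemma SES.shortExact {X Y Z : C} {f : X ⟶ Y} {g : Y ⟶ Z} (h : SES f g) :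
    (ShortComplex.mk f g h.2.2.1).ShortExact := by
  obtain ⟨hf, hg, hz, hl⟩ := h
  have : Mono f := hf
  have : Epi g := hg
  refine ShortComplex.ShortExact.mk' ?_ hf hg
  refine ShortComplex.exact_of_f_is_kernel _ (KernelFork.IsLimit.ofι' _ _ ?_)
  intro W x hx
  exact ⟨(hl x hx).choose, (hl x hx).choose_spec⟩

lemma SES.of_epi {Y Z : C} (g : Y ⟶ Z) [Epi g] : SES (kernel.ι g) g :=
  ⟨inferInstance, inferInstance, kernel.condition g,
    fun _ x hx => ⟨kernel.lift g x hx, kernel.lift_ι g x hx⟩⟩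

/-- Pulling back a short exact sequence. -/
lemma SES.pullback {X Y Z V : C} {f : X ⟶ Y} {g : Y ⟶ Z} (h : SES f g) (t : V ⟶ Z) :
    ∃ (P : C) (a : P ⟶ Y) (b : P ⟶ V) (j : X ⟶ P), IsPullback a b g t ∧ SES j b := by
  obtain ⟨hf, hg, hz, hl⟩ := h
  have hp := IsPullback.of_hasPullback g t
  refine ⟨_, _, _, hp.lift f 0 (by simp [hz]), hp, ?_, inferInstance, by simp, ?_⟩
  · have : Mono (hp.lift f 0 (by simp [hz]) ≫ pullback.fst g t) := by simpa using hf
    exact mono_of_mono _ (pullback.fst g t)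
  · intro W x hx
    obtain ⟨y, hy⟩ := hl (x ≫ pullback.fst g t) (by rw [Category.assoc, pullback.condition,
      reassoc_of% hx, zero_comp])
    refine ⟨y, hp.hom_ext ?_ ?_⟩
    · simp [hy]
    · simp [hx]

/-! ### `add U` -/

lemma AddP.zero (U : C) {Z : C} (hZ : IsZero Z) : AddP U Z :=
  ⟨0, 0, 0, hZ.eq_of_src _ _⟩

lemma AddP.biprod {U A B : C} (hA : AddP U A) (hB : AddP U B) : AddP U (A ⊞ B) := by
  obtain ⟨k, i, p, hip⟩ := hA
  obtain ⟨l, i', p', hip'⟩ := hB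
  refine ⟨k + l,
    biprod.desc (i ≫ biproduct.desc fun a => biproduct.ι (fun _ : Fin (k + l) => U) (Fin.castAdd l a))
      (i' ≫ biproduct.desc fun b => biproduct.ι (fun _ : Fin (k + l) => U) (Fin.natAdd k b)),
    biproduct.desc (fun j => Fin.addCases
      (motive := fun _ => (U ⟶ A ⊞ B))
      (fun a => biproduct.ι (fun _ : Fin k => U) a ≫ p ≫ biprod.inl)
      (fun b => biproduct.ι (fun _ : Fin l => U) b ≫ p' ≫ biprod.inr) j), ?_⟩
  have e1 : (biproduct.desc fun a => biproduct.ι (fun _ : Fin (k + l) => U) (Fin.castAdd l a)) ≫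
      biproduct.desc (fun j => Fin.addCases
      (motive := fun _ => (U ⟶ A ⊞ B))
      (fun a => biproduct.ι (fun _ : Fin k => U) a ≫ p ≫ biprod.inl)
      (fun b => biproduct.ι (fun _ : Fin l => U) b ≫ p' ≫ biprod.inr) j) = p ≫ biprod.inl := by
    apply biproduct.hom_ext'
    intro j
    simp
  have e2 : (biproduct.desc fun b => biproduct.ι (fun _ : Fin (k + l) => U) (Fin.natAdd k b)) ≫
      biproduct.desc (fun j => Fin.addCases
      (motive := fun _ => (U ⟶ A ⊞ B))
      (fun a => biproduct.ι (fun _ : Fin k => U) a ≫ p ≫ biprod.inl)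
      (fun b => biproduct.ι (fun _ : Fin l => U) b ≫ p' ≫ biprod.inr) j) = p' ≫ biprod.inr := by
    apply biproduct.hom_ext'
    intro j
    simp
  apply biprod.hom_ext'
  · simp only [biprod.inl_desc_assoc, Category.assoc, e1, Category.comp_id]
    rw [reassoc_of% hip]
  · simp only [biprod.inr_desc_assoc, Category.assoc, e2, Category.comp_id]
    rw [reassoc_of% hip']

/-- The vanishing of `Ext¹(U, Fac U)`. -/
def Rigid (U : C) : Prop :=
  ∀ ⦃M E : C⦄ (f : M ⟶ E) (g : E ⟶ U) (w : f ≫ g = 0),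
      (ShortComplex.mk f g w).ShortExact → FacP U M → ∃ s : U ⟶ E, s ≫ g = 𝟙 U

lemma Rigid.lift {U : C} (hU : Rigid U) {X Y Z A : C} {f : X ⟶ Y} {g : Y ⟶ Z} (h : SES f g)
    (hX : FacP U X) (hA : AddP U A) (t : A ⟶ Z) : ∃ l : A ⟶ Y, l ≫ g = t := by
  have key : ∀ s : U ⟶ Z, ∃ l : U ⟶ Y, l ≫ g = s := by
    intro s
    obtain ⟨P, a, b, j, hp, hs⟩ := h.pullback s
    obtain ⟨r, hr⟩ := hU j b hs.2.2.1 hs.shortExact hX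
    exact ⟨r ≫ a, by rw [Category.assoc, hp.w, reassoc_of% hr]⟩
  obtain ⟨k, i, p, hip⟩ := hA
  choose l hl using fun j : Fin k => key (biproduct.ι (fun _ : Fin k => U) j ≫ p ≫ t)
  refine ⟨i ≫ biproduct.desc l, ?_⟩
  have : biproduct.desc l ≫ g = p ≫ t := by
    apply biproduct.hom_ext'
    intro j
    simp [hl]
  rw [Category.assoc, this, reassoc_of% hip]

/-! ### Iterated cokernels -/

/-- Recursive form of `cok_{n-1} U`. -/
def Q (Amb : C → Prop) (U : C) : ℕ → (C → Prop)
  | 0 => Amb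
  | (n+1) => fun M => ∃ (K A : C) (f : K ⟶ A) (g : A ⟶ M), SES f g ∧ AddP U A ∧ Q Amb U n K

/-- The morphism `f` is the last morphism of an exact sequence of length `n + 1` whose terms,
except for the last one, are in `add U`. -/
def Sq (U : C) : ℕ → ∀ {X Y : C}, (X ⟶ Y) → Prop
  | 0, X, _, _ => AddP U X
  | (n+1), X, _, f => AddP U X ∧ ∃ (W : C) (g : W ⟶ X) (w : g ≫ f = 0),
      (ShortComplex.mk g f w).Exact ∧ Sq U n g

lemma Sq.comp_mono {U : C} {n : ℕ} {X Y Z : C} (f : X ⟶ Y) (m : Y ⟶ Z) [Mono m] :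
    Sq U n (f ≫ m) ↔ Sq U n f := by
  cases n with
  | zero => exact Iff.rfl
  | succ n =>
    refine and_congr Iff.rfl (exists_congr fun W => exists_congr fun g => ?_)
    have e : g ≫ f ≫ m = 0 ↔ g ≫ f = 0 := by
      rw [← Category.assoc, ← cancel_mono m, zero_comp]
    have key : ∀ (w : g ≫ f = 0), (ShortComplex.mk g f w).Exact ↔
        (ShortComplex.mk g (f ≫ m) (e.2 w)).Exact := fun w =>
      ShortComplex.exact_iff_of_epi_of_isIso_of_mono
        (S₁ := ShortComplex.mk g f w) (S₂ := ShortComplex.mk g (f ≫ m) (e.2 w))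
        { τ₁ := 𝟙 _, τ₂ := 𝟙 _, τ₃ := m }
    constructor
    · rintro ⟨w, h, h'⟩
      exact ⟨e.1 w, (key _).2 h, h'⟩
    · rintro ⟨w, h, h'⟩
      exact ⟨e.2 w, (key _).1 h, h'⟩

/-- Hypotheses on the ambient subcategory. -/
structure AmbOK (Amb : C → Prop) (U : C) : Prop where
  add : ∀ M, AddP U M → Amb M
  sub : ∀ ⦃X Y : C⦄ (f : X ⟶ Y), Mono f → Amb Y → Amb X
  quot : ∀ ⦃X Y : C⦄ (f : X ⟶ Y), Epi f → Amb X → Amb Y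
  ext : ∀ ⦃X Y Z : C⦄ (f : X ⟶ Y) (g : Y ⟶ Z), SES f g → Amb X → Amb Z → Amb Y

lemma Q_succ_iff_Sq {Amb : C → Prop} {U : C} (hA : AmbOK Amb U) (n : ℕ) (M : C) :
    Q Amb U (n+1) M ↔ ∃ (X : C) (f : X ⟶ M), Epi f ∧ Sq U n f := by
  induction n generalizing M with
  | zero =>
    constructor
    · rintro ⟨K, A, f, g, h, hA', -⟩
      exact ⟨A, g, h.2.1, hA'⟩
    · rintro ⟨A, g, hg, hA'⟩
      exact ⟨_, A, _, g, SES.of_epi g, hA', hA.sub (kernel.ι g) inferInstance (hA.add _ hA')⟩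
  | succ n ih =>
    constructor
    · rintro ⟨K, A, f, g, h, hA', hK⟩
      obtain ⟨X, e, he, hs⟩ := (ih K).1 hK
      have := h.1
      refine ⟨A, g, h.2.1, hA', X, e ≫ f, by rw [Category.assoc, h.2.2.1, comp_zero], ?_,
        (Sq.comp_mono e f).2 hs⟩
      exact (ShortComplex.exact_iff_of_epi_of_isIso_of_mono
        (S₁ := ShortComplex.mk (e ≫ f) g (by rw [Category.assoc, h.2.2.1, comp_zero]))
        (S₂ := ShortComplex.mk f g h.2.2.1)
        { τ₁ := e, τ₂ := 𝟙 _, τ₃ := 𝟙 _ }).2 h.shortExact.exact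
    · rintro ⟨A, g, hg, hA', W, e, w, hex, hs⟩
      refine ⟨_, A, _, g, SES.of_epi g, hA', (ih _).2 ⟨W, kernel.lift g e w,
        hex.epi_kernelLift, ?_⟩⟩
      rw [← Sq.comp_mono _ (kernel.ι g), kernel.lift_ι]
      exact hs

lemma Sq_of_arrows {U : C} (n : ℕ) (F : ComposableArrows C (n+1)) (hF : F.Exact)
    (h : ∀ (i : ℕ) (hi : i ≤ n), AddP U (F.obj ⟨i, by omega⟩)) :
    Sq U n (F.map' n (n+1) (by omega) (by omega)) := by
  induction n with
  | zero => exact h 0 le_rfl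
  | succ n ih =>
    refine ⟨h (n+1) le_rfl, F.obj ⟨n, by omega⟩, F.map' n (n+1) (by omega) (by omega),
      hF.toIsComplex.zero n, hF.exact n, ?_⟩
    exact ih F.δlast hF.δlast (fun i hi => h i (by omega))

lemma CokP_of_Sq {Amb : C → Prop} {U M : C} (n : ℕ) : ∀ (m : ℕ) (G : ComposableArrows C (m+1))
    (_ : G.Exact) (_ : Epi (G.map' m (m+1) (by omega) (by omega)))
    (_ : ∀ (i : ℕ) (hi : i ≤ m), AddP U (G.obj ⟨i, by omega⟩))
    (_ : G.obj ⟨m+1, by omega⟩ = M)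
    (_ : Sq U n (G.map' 0 1 (by omega) (by omega))), CokP Amb U (n + m + 1) M := by
  induction n with
  | zero =>
    intro m G h1 h2 h3 h4 _
    rw [Nat.zero_add]
    exact ⟨G, h1, h2, h3, h4⟩
  | succ n ih =>
    intro m G h1 h2 h3 h4 h5
    obtain ⟨hX, W, g, w, hex, hs⟩ := h5
    have e : n + 1 + m + 1 = n + (m + 1) + 1 := by omega
    rw [e]
    refine ih (m+1) (G.precomp g) ?_ h2 ?_ h4 hs
    · exact ComposableArrows.exact_of_δ₀ (ComposableArrows.exact₂_mk _ w hex) h1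
    · intro i hi
      cases i with
      | zero =>
        cases n with
        | zero => exact hs
        | succ n => exact hs.1
      | succ i => exact h3 i (by omega)

lemma CokP_iff_Q {Amb : C → Prop} {U : C} (hA : AmbOK Amb U) (n : ℕ) (M : C) :
    CokP Amb U n M ↔ Q Amb U n M := by
  cases n with
  | zero => exact Iff.rfl
  | succ n =>
    rw [Q_succ_iff_Sq hA]
    constructor
    · rintro ⟨F, h1, h2, h3, rfl⟩
      exact ⟨_, _, h2, Sq_of_arrows n F h1 h3⟩
    · rintro ⟨X, f, hf, hs⟩
      refine CokP_of_Sq (Amb := Amb) n 0 (ComposableArrows.mk₁ f) (ComposableArrows.exact₁ _) hf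
        ?_ rfl hs
      intro i hi
      obtain rfl : i = 0 := by omega
      cases n with
      | zero => exact hs
      | succ n => exact hs.1

/-! ### The main argument -/

section main

variable {Amb : C → Prop} {U : C}

lemma Q_iso (hA : AmbOK Amb U) (n : ℕ) : IsoClosedP (Q Amb U n) := by
  intro A B e h
  cases n with
  | zero => exact hA.quot e.hom inferInstance h
  | succ n =>
    obtain ⟨K, X, f, g, ⟨h1, h2, h3, h4⟩, hX, hK⟩ := h
    refine ⟨K, X, f, g ≫ e.hom, ⟨h1, inferInstance, by rw [reassoc_of% h3, zero_comp], ?_⟩, hX, hK⟩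
    intro W x hx
    refine h4 x ?_
    rw [← cancel_mono e.hom, Category.assoc, hx, zero_comp]

lemma Q_add (hA : AmbOK Amb U) (n : ℕ) : ∀ M, AddP U M → Q Amb U n M := by
  induction n with
  | zero => exact hA.add
  | succ n ih =>
    intro M hM
    obtain ⟨Z, hZ⟩ := HasZeroObject.zero (C := C)
    refine ⟨Z, M, 0, 𝟙 M, ⟨⟨fun _ _ _ => hZ.eq_of_tgt _ _⟩, inferInstance, by simp, ?_⟩, hM,
      ih _ (AddP.zero U hZ)⟩
    intro W x hx
    exact ⟨0, by simpa using hx.symm⟩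

lemma Q_mono (hA : AmbOK Amb U) (n : ℕ) : ∀ M, Q Amb U (n+1) M → Q Amb U n M := by
  induction n with
  | zero =>
    rintro M ⟨K, A, f, g, h, hX, -⟩
    exact hA.quot g h.2.1 (hA.add _ hX)
  | succ n ih =>
    rintro M ⟨K, A, f, g, h, hX, hK⟩
    exact ⟨K, A, f, g, h, hX, ih K hK⟩

lemma Q_ext (hA : AmbOK Amb U) (hU : Rigid U) (n : ℕ) :
    ∀ ⦃X Y Z : C⦄ (f : X ⟶ Y) (g : Y ⟶ Z), SES f g → Q Amb U n X → Q Amb U n Z →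
      Q Amb U n Y := by
  induction n with
  | zero => exact hA.ext
  | succ n ih =>
    rintro X Y Z f g h ⟨K₁, A₁, k₁, p₁, h₁, hA₁, hK₁⟩ ⟨K₃, A₃, k₃, p₃, h₃, hA₃, hK₃⟩
    obtain ⟨l, hl⟩ := hU.lift h ⟨A₁, p₁, hA₁, h₁.2.1⟩ hA₃ p₃
    obtain ⟨t, ht⟩ := h.2.2.2 (k₃ ≫ l) (by rw [Category.assoc, hl, h₃.2.2.1])
    obtain ⟨P, a, b, j, hp, hs⟩ := h₁.pullback t
    have hK₂ := ih j b hs hK₁ hK₃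
    have := h.1
    have := h₃.1
    have := h₁.2.1
    have := h₃.2.1
    refine ⟨P, A₁ ⊞ A₃, biprod.lift a (-(b ≫ k₃)), biprod.desc (p₁ ≫ f) l, ⟨?_, ?_, ?_, ?_⟩,
      hA₁.biprod hA₃, hK₂⟩
    · apply Preadditive.mono_of_cancel_zero
      intro W x hx
      have e1 : x ≫ a = 0 := by simpa using hx =≫ biprod.fst
      have e2 : x ≫ b ≫ k₃ = 0 := by simpa using hx =≫ biprod.snd
      refine hp.hom_ext (by simp [e1]) ?_
      rw [← cancel_mono k₃]
      simp [e2]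
    · apply Preadditive.epi_of_cancel_zero
      intro W z hz
      have e1 : p₁ ≫ f ≫ z = 0 := by simpa using biprod.inl ≫= hz
      have e2 : l ≫ z = 0 := by simpa using biprod.inr ≫= hz
      have e3 : f ≫ z = 0 := by rw [← cancel_epi p₁, e1, comp_zero]
      have hse := h.shortExact
      have : Epi (ShortComplex.mk f g h.2.2.1).g := h.2.1
      have e4 := hse.exact.g_desc z e3
      have e5 : p₃ ≫ hse.exact.desc z e3 = 0 := by
        rw [← hl, Category.assoc]
        exact (congrArg (fun q => l ≫ q) e4).trans e2
      have e6 : hse.exact.desc z e3 = 0 := by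
        rw [← cancel_epi p₃]
        exact e5.trans comp_zero.symm
      rw [← e4, e6, comp_zero]
    · rw [biprod.lift_desc, ← Category.assoc, hp.w, Preadditive.neg_comp, Category.assoc,
        Category.assoc, ht, add_neg_cancel]
    · intro W x hx
      have hx' : x ≫ biprod.fst ≫ p₁ ≫ f + x ≫ biprod.snd ≫ l = 0 := by
        rw [biprod.desc_eq] at hx
        simpa using hx
      have e1 : (x ≫ biprod.snd) ≫ p₃ = 0 := by
        have := hx' =≫ g
        simpa [h.2.2.1, hl] using this
      obtain ⟨y, hy⟩ := h₃.2.2.2 _ e1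
      have e2 : (x ≫ biprod.fst) ≫ p₁ = (-y) ≫ t := by
        rw [← cancel_mono f]
        simp only [Category.assoc, Preadditive.neg_comp, ht, reassoc_of% hy]
        exact eq_neg_of_add_eq_zero_left hx'
      refine ⟨hp.lift _ _ e2, ?_⟩
      apply biprod.hom_ext
      · simp
      · simp [hy]

lemma Q_quot (hA : AmbOK Amb U) (hU : Rigid U) (n : ℕ)
    ⦃X Y Z : C⦄ (f : X ⟶ Y) (g : Y ⟶ Z) (h : SES f g) (hX : Q Amb U n X)
    (hY : Q Amb U (n+1) Y) : Q Amb U (n+1) Z := by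
  obtain ⟨K, A, k, p, hp, hA', hK⟩ := hY
  obtain ⟨P, a, b, j, hP, hs⟩ := hp.pullback f
  have hPQ := Q_ext hA hU n j b hs hK hX
  have := h.1
  have := h.2.1
  have := hp.2.1
  refine ⟨P, A, a, p ≫ g, ⟨?_, inferInstance, ?_, ?_⟩, hA', hPQ⟩
  · apply Preadditive.mono_of_cancel_zero
    intro W x hx
    refine hP.hom_ext (by simp [hx]) ?_
    rw [← cancel_mono f, Category.assoc, ← hP.w, reassoc_of% hx]
    simp
  · rw [← Category.assoc, hP.w, Category.assoc, h.2.2.1, comp_zero]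
  · intro W x hx
    obtain ⟨y, hy⟩ := h.2.2.2 (x ≫ p) (by rw [Category.assoc, hx])
    exact ⟨hP.lift x y hy.symm, by simp⟩

lemma Q_torsion (hA : AmbOK Amb U) (hU : Rigid U) (n : ℕ) :
    IsTorsionClassOf (Q Amb U n) (Q Amb U (n+1)) :=
  ⟨Q_iso hA _, Q_mono hA n,
    fun S hS _ _ _ h1 h3 => Q_ext hA hU (n+1) S.f S.g (SES.of_shortExact hS) h1 h3,
    fun S hS h1 _ _ h2 => Q_quot hA hU n S.f S.g (SES.of_shortExact hS) h1 h2⟩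

lemma Q_smallest (hA : AmbOK Amb U) (hU : Rigid U) (n : ℕ) :
    IsSmallestTorsionClassOf (Q Amb U n) (AddP U) (Q Amb U (n+1)) := by
  refine ⟨Q_torsion hA hU n, Q_add hA _, ?_⟩
  intro G hG hGU M hM
  have hM' := Q_mono hA n M hM
  obtain ⟨K, A, f, g, h, hA', hK⟩ := hM
  exact hG.2.2.2 _ h.shortExact hK (Q_add hA n A hA') hM' (hGU A hA')

theorem main_abstract (hA : AmbOK Amb U) (hU : Rigid U) (n : ℕ) (T : ℕ → (C → Prop))
    (hT0 : T 0 = Amb)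
    (hT : ∀ k, k < n → IsSmallestTorsionClassOf (T k) (AddP U) (T (k+1))) :
    (∀ M, CokP Amb U n M ↔ T n M) ∧ IsNFoldTorsionClass Amb (CokP Amb U n) n ∧
      ClosedUnderExtensions (CokP Amb U n) := by
  have hQ : CokP Amb U n = Q Amb U n := funext fun M => propext (CokP_iff_Q hA n M)
  rw [hQ]
  have key : ∀ k, k ≤ n → T k = Q Amb U k := by
    intro k
    induction k with
    | zero => intro _; exact hT0
    | succ k ih =>
      intro hk
      have h1 := hT k (by omega)
      rw [ih (by omega)] at h1
      have h2 := Q_smallest hA hU k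
      funext M
      exact propext ⟨h1.2.2 _ h2.1 h2.2.1 M, h2.2.2 _ h1.1 h1.2.1 M⟩
  refine ⟨fun M => by rw [key n le_rfl], ⟨Q Amb U, rfl, rfl, fun i _ => Q_torsion hA hU i⟩, ?_⟩
  intro S hS h1 h3
  exact Q_ext hA hU n S.f S.g (SES.of_shortExact hS) h1 h3

end main

lemma ambOK_finite (Λ : Type u) [Ring Λ] [IsNoetherianRing Λ] (U : ModuleCat.{u} Λ)
    (hUfg : Module.Finite Λ U.carrier) :
    AmbOK (fun M : ModuleCat.{u} Λ => Module.Finite Λ M.carrier) U where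
  add := by
    rintro M ⟨k, i, p, hip⟩
    have h1 : Module.Finite Λ (∀ _ : Fin k, U) := inferInstance
    have h2 : Module.Finite Λ (⨁ fun _ : Fin k => U : ModuleCat.{u} Λ) :=
      Module.Finite.equiv (ModuleCat.biproductIsoPi (fun _ : Fin k => U)).toLinearEquiv.symm
    refine Module.Finite.of_surjective p.hom ?_
    have : IsSplitEpi p := ⟨⟨⟨i, hip⟩⟩⟩
    exact (ModuleCat.epi_iff_surjective p).1 inferInstance
  sub := by
    intro X Y f hf hY
    exact Module.Finite.of_injective f.hom ((ModuleCat.mono_iff_injective f).1 hf)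
  quot := by
    intro X Y f hf hX
    exact Module.Finite.of_surjective f.hom ((ModuleCat.epi_iff_surjective f).1 hf)
  ext := by
    intro X Y Z f g h hX hZ
    have hex := (ShortComplex.ShortExact.moduleCat_exact_iff_function_exact _).1 h.shortExact.exact
    have := isNoetherian_of_range_eq_ker (M := X) (N := Y) (P := Z) f.hom g.hom
      (LinearMap.exact_iff.1 hex).symm
    infer_instance

/-- `mod Λ` is realized as the subcategory of finitely generated
modules inside `ModuleCat Λ`; τ-rigidity of `U` is expressed by the equivalent
condition `Ext¹(U, Fac U) = 0`, i.e. every short exact sequence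
`0 → M → E → U → 0` with `M ∈ Fac U` splits. -/
theorem statement15 (𝕜 : Type u) [Field 𝕜] [IsAlgClosed 𝕜]
    (Λ : Type u) [Ring Λ] [Algebra 𝕜 Λ] [FiniteDimensional 𝕜 Λ]
    (U : ModuleCat.{u} Λ) (hUfg : Module.Finite Λ U.carrier)
    (hU : ∀ ⦃M E : ModuleCat.{u} Λ⦄ (f : M ⟶ E) (g : E ⟶ U) (w : f ≫ g = 0),
      (ShortComplex.mk f g w).ShortExact → FacP U M → ∃ s : U ⟶ E, s ≫ g = 𝟙 U)
    (n : ℕ) (T : ℕ → (ModuleCat.{u} Λ → Prop))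
    (hT0 : T 0 = fun M => Module.Finite Λ M.carrier)
    (hT : ∀ k, k < n → IsSmallestTorsionClassOf (T k) (AddP U) (T (k+1))) :
    (∀ M, CokP (fun M : ModuleCat.{u} Λ => Module.Finite Λ M.carrier) U n M ↔ T n M) ∧
    IsNFoldTorsionClass (fun M : ModuleCat.{u} Λ => Module.Finite Λ M.carrier)
      (CokP (fun M : ModuleCat.{u} Λ => Module.Finite Λ M.carrier) U n) n ∧
    ClosedUnderExtensions
      (CokP (fun M : ModuleCat.{u} Λ => Module.Finite Λ M.carrier) U n) := by
  have : IsNoetherianRing Λ := isNoetherian_of_tower 𝕜 inferInstance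
  exact main_abstract (ambOK_finite Λ U hUfg) hU n T hT0 hT
end Paper
end
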